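/- Let D ∈ ℝ^{E×V}, let Γ ∈ ℝ^{V×V} and Λ ∈ ℝ^{E×E} be positive definite diagonal matrices, Q = {x ∈ ℝ^V : x[i] = x̃_i for all i ∈ M}, and let x̂^{(k−1)}, x̂^{(k)} ∈ ℝ^V, ŷ^{(k)} ∈ ℝ^E be given. Define x̄ = 2x̂^{(k)} − x̂^{(k−1)}, let ŷ^{(k+1)} be the minimizer over {z : ‖z‖_∞ ≤ 1} of (1/2)(ŷ^{(k)} + ΛD x̄ − z)ᵀΛ⁻¹(ŷ^{(k)} + ΛD x̄ − z), and let x̂^{(k+1)} be the minimizer over Q of (1/2)(x̂^{(k)} − ΓDᵀŷ^{(k+1)} − z)ᵀΓ⁻¹(x̂^{(k)} − ΓDᵀŷ^{(k+1)} − z). Then for every x ∈ Q and every y with ‖y‖_∞ ≤ 1: ‖y − ŷ^{(k)}‖²_{Λ⁻¹} + ‖x − x̂^{(k)}‖²_{Γ⁻¹} ≥ 2 yᵀD x̂^{(k+1)} − 2 (ŷ^{(k+1)})ᵀD x + ‖y − ŷ^{(k+1)}‖²_{Λ⁻¹} + ‖x − x̂^{(k+1)}‖²_{Γ⁻¹}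 + ‖ŷ^{(k)} − ŷ^{(k+1)}‖²_{Λ⁻¹} + ‖x̂^{(k)} − x̂^{(k+1)}‖²_{Γ⁻¹} + 2 (x̂^{(k+1)} − x̄)ᵀ Dᵀ (ŷ^{(k+1)} − y). -/

import Mathlib

open Matrix Finset

noncomputable section

/-- The ℓ¹-norm of a finitely indexed real vector. -/
def l1Norm {ι : Type*} [Fintype ι] (u : ι → ℝ) : ℝ := ∑ i, |u i|

/-- The squared weighted norm `‖u‖²_Q = uᵀ Q u`. -/
def wnormSq {ι : Type*} [Fintype ι] (Q : Matrix ι ι ℝ) (u : ι → ℝ) : ℝ := u ⬝ᵥ (Q *ᵥ u)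

/-- The closed ℓ∞ unit ball `{y : ‖y‖_∞ ≤ 1}`. -/
def linfBall (ι : Type*) : Set (ι → ℝ) := {y | ∀ e, |y e| ≤ 1}

/-- `a` minimizes `f` over the set `S`. -/
def IsMinimizer {α : Type*} (S : Set α) (f : α → ℝ) (a : α) : Prop :=
  a ∈ S ∧ ∀ b ∈ S, f a ≤ f b

/-- Entrywise square root of the diagonal matrix with diagonal `g`. -/
def diagSqrt {ι : Type*} [Fintype ι] [DecidableEq ι] (g : ι → ℝ) : Matrix ι ι ℝ :=
  Matrix.diagonal (fun i => Real.sqrt (g i))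

/-- The spectral norm `‖A‖₂ = sup_{‖u‖₂ = 1} ‖A u‖₂` of a real matrix. -/
def specNorm {m n : Type*} [Fintype m] [Fintype n] [DecidableEq n] (A : Matrix m n ℝ) : ℝ :=
  ‖LinearMap.toContinuousLinearMap (Matrix.toEuclideanLin A)‖

/-- Objective of the dual resolvent step: `z ↦ ½ (ŷ + Λ D x̄ − z)ᵀ Λ⁻¹ (ŷ + Λ D x̄ − z)`. -/
def slpDualObj {V E : Type*} [Fintype V] [Fintype E] [DecidableEq E]
    (D : Matrix E V ℝ) (Λ : Matrix E E ℝ) (yk : E → ℝ) (xbar : V → ℝ) (z : E → ℝ) : ℝ :=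
  (1/2) * wnormSq Λ⁻¹ (yk + Λ *ᵥ (D *ᵥ xbar) - z)

/-- Objective of the primal resolvent step: `z ↦ ½ (x̂ − Γ Dᵀ v − z)ᵀ Γ⁻¹ (x̂ − Γ Dᵀ v − z)`. -/
def slpPrimalObj {V E : Type*} [Fintype V] [Fintype E] [DecidableEq V]
    (D : Matrix E V ℝ) (Γ : Matrix V V ℝ) (xk : V → ℝ) (v : E → ℝ) (z : V → ℝ) : ℝ :=
  (1/2) * wnormSq Γ⁻¹ (xk - Γ *ᵥ (Dᵀ *ᵥ v) - z)

/-- The SLP update rule: starting from `xs 0` (with `x^{(-1)} = x^{(0)}`, encoded via truncated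
subtraction `0 - 1 = 0`) and `ys 0`, the iterate `ys (k+1)` minimizes the dual resolvent
objective over the ℓ∞ unit ball and `xs (k+1)` minimizes the primal resolvent objective
over the constraint set `Q`. -/
def SLPSequences {V E : Type*} [Fintype V] [Fintype E] [DecidableEq V] [DecidableEq E]
    (D : Matrix E V ℝ) (Γ : Matrix V V ℝ) (Λ : Matrix E E ℝ) (Q : Set (V → ℝ))
    (xs : ℕ → V → ℝ) (ys : ℕ → E → ℝ) : Prop :=
  ∀ k : ℕ,
    IsMinimizer (linfBall E) (slpDualObj D Λ (ys k) ((2:ℝ) • xs k - xs (k-1))) (ys (k+1)) ∧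
    IsMinimizer Q (slpPrimalObj D Γ (xs k) (ys (k+1))) (xs (k+1))

/-- An empirical graph: an undirected weighted graph together with a fixed orientation
assigning each edge `e` a head `e⁺` and a tail `e⁻`, with positive weights, no self-loops,
and distinct edges joining distinct node pairs. -/
structure EmpiricalGraph (V E : Type*) where
  head : E → V
  tail : E → V
  w : E → ℝ
  w_pos : ∀ e, 0 < w e
  no_self_loop : ∀ e, head e ≠ tail e
  edge_inj : Function.Injective (fun e => ({head e, tail e} : Set V))

/-- The simple graph underlying an empirical graph. -/
def EmpiricalGraph.toSimpleGraph {V E : Type*} (G : EmpiricalGraph V E) : SimpleGraph V :=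
  SimpleGraph.fromRel (fun i j => ∃ e, G.head e = i ∧ G.tail e = j)

/-- Weighted node degree `d_i = ∑_{j ∈ N(i)} W_{i,j}`. -/
def EmpiricalGraph.deg {V E : Type*} [Fintype E] [DecidableEq V]
    (G : EmpiricalGraph V E) (i : V) : ℝ :=
  ∑ e, ((if G.head e = i then G.w e else 0) + (if G.tail e = i then G.w e else 0))

/-- Weighted oriented incidence matrix `D ∈ ℝ^{E×V}`: `D_{e,e⁺} = W_e`, `D_{e,e⁻} = −W_e`. -/
def EmpiricalGraph.incidence {V E : Type*} [DecidableEq V]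
    (G : EmpiricalGraph V E) : Matrix E V ℝ :=
  Matrix.of fun e i => if G.head e = i then G.w e else if G.tail e = i then -G.w e else 0


theorem wnormSq_sub {ι : Type*} [Fintype ι] {A : Matrix ι ι ℝ} (hA : A.IsSymm) (u v : ι → ℝ) :
    wnormSq A (u - v) = wnormSq A u - 2 * (v ⬝ᵥ (A *ᵥ u)) + wnormSq A v := by
  have h : u ⬝ᵥ (A *ᵥ v) = v ⬝ᵥ (A *ᵥ u) := by
    rw [dotProduct_mulVec, ← mulVec_transpose, hA.eq, dotProduct_comm]
  simp only [wnormSq, mulVec_sub, sub_dotProduct, dotProduct_sub, h]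
  ring

theorem wnormSq_smul {ι : Type*} [Fintype ι] (A : Matrix ι ι ℝ) (t : ℝ) (v : ι → ℝ) :
    wnormSq A (t • v) = t ^ 2 * wnormSq A v := by
  simp only [wnormSq, mulVec_smul, smul_dotProduct, dotProduct_smul, smul_eq_mul]
  ring

/-- The variational inequality for a weighted projection `a` of `c` onto a convex set. -/
theorem IsMinimizer.dotProduct_mulVec_nonpos {ι : Type*} [Fintype ι] {A : Matrix ι ι ℝ}
    (hA : A.IsSymm) {S : Set (ι → ℝ)} (hS : Convex ℝ S) {c a : ι → ℝ}
    (ha : IsMinimizer S (fun z => (1 / 2) * wnormSq A (c - z)) a) {b : ι → ℝ} (hb : b ∈ S) :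
    (b - a) ⬝ᵥ (A *ᵥ (c - a)) ≤ 0 := by
  by_contra! hB
  set B := (b - a) ⬝ᵥ (A *ᵥ (c - a)) with hBdef
  set C := wnormSq A (b - a) with hCdef
  obtain ⟨t, ht0, ht1, htC⟩ : ∃ t : ℝ, 0 < t ∧ t ≤ 1 ∧ t * C ≤ B := by
    have hC : 0 < |C| + 1 := by positivity
    refine ⟨min 1 (B / (|C| + 1)), lt_min one_pos (div_pos hB hC), min_le_left _ _, ?_⟩
    have ht : 0 ≤ min 1 (B / (|C| + 1)) := le_min zero_le_one (div_pos hB hC).le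
    calc min 1 (B / (|C| + 1)) * C ≤ min 1 (B / (|C| + 1)) * (|C| + 1) :=
          mul_le_mul_of_nonneg_left (by linarith [le_abs_self C]) ht
      _ ≤ B / (|C| + 1) * (|C| + 1) := mul_le_mul_of_nonneg_right (min_le_right _ _) hC.le
      _ = B := div_mul_cancel₀ _ hC.ne'
  have hmin := ha.2 _ (hS.add_smul_sub_mem ha.1 hb ⟨ht0.le, ht1⟩)
  simp only [← sub_sub] at hmin
  rw [wnormSq_sub hA (c - a), wnormSq_smul, smul_dotProduct, smul_eq_mul, ← hBdef,
    ← hCdef] at hmin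
  nlinarith [mul_le_mul_of_nonneg_left htC ht0.le, mul_pos ht0 hB]

/-- The three-point inequality for a resolvent step `a` from `p` in direction `q`. -/
theorem IsMinimizer.wnormSq_three_point {ι : Type*} [Fintype ι] [DecidableEq ι]
    {P : Matrix ι ι ℝ} (hP : P.IsSymm) (hdet : IsUnit P.det)
    {S : Set (ι → ℝ)} (hS : Convex ℝ S) {p q a : ι → ℝ}
    (ha : IsMinimizer S (fun z => (1 / 2) * wnormSq P⁻¹ (p + P *ᵥ q - z)) a)
    {b : ι → ℝ} (hb : b ∈ S) :
    wnormSq P⁻¹ (b - a) + wnormSq P⁻¹ (p - a) + 2 * ((b - a) ⬝ᵥ q) ≤ wnormSq P⁻¹ (b - p) := by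
  have hA : P⁻¹.IsSymm := by rw [Matrix.IsSymm, transpose_nonsing_inv, hP.eq]
  have hvar := ha.dotProduct_mulVec_nonpos hA hS hb
  have hsplit : p + P *ᵥ q - a = (p - a) + P *ᵥ q := by abel
  rw [hsplit, mulVec_add, mulVec_mulVec, nonsing_inv_mul P hdet, one_mulVec,
    dotProduct_add] at hvar
  have hexp := wnormSq_sub hA (p - a) (b - a)
  have hneg : wnormSq P⁻¹ (b - p) = wnormSq P⁻¹ (p - a - (b - a)) := by
    have h : b - p = -(p - a - (b - a)) := by abel
    rw [h, wnormSq, mulVec_neg, neg_dotProduct_neg, wnormSq]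
  linarith

theorem isUnit_det_diagonal_of_pos {ι : Type*} [Fintype ι] [DecidableEq ι] {g : ι → ℝ}
    (hg : ∀ i, 0 < g i) : IsUnit (Matrix.diagonal g).det := by
  rw [det_diagonal]
  exact (Finset.prod_pos fun i _ => hg i).ne'.isUnit

theorem convex_linfBall (ι : Type*) : Convex ℝ (linfBall ι) := by
  intro u hu v hv s t hs ht hst e
  have h1 := abs_le.mp (hu e)
  have h2 := abs_le.mp (hv e)
  simp only [Pi.add_apply, Pi.smul_apply, smul_eq_mul]
  rw [abs_le]
  constructor <;> nlinarith

theorem convex_setOf_eqOn {ι : Type*} (M : Set ι) (w : ι → ℝ) :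
    Convex ℝ {x : ι → ℝ | ∀ i ∈ M, x i = w i} := by
  intro u hu v hv s t _ _ hst i hi
  simp only [Pi.add_apply, Pi.smul_apply, smul_eq_mul, hu i hi, hv i hi]
  rw [← add_mul, hst, one_mul]

/-- single-iteration estimate for the SLP update. With
`x̄ = 2x̂⁽ᵏ⁾ − x̂⁽ᵏ⁻¹⁾`, `ŷ⁽ᵏ⁺¹⁾` the dual resolvent step and `x̂⁽ᵏ⁺¹⁾` the primal
resolvent step, for every `x ∈ Q` and `‖y‖_∞ ≤ 1`:
`‖y − ŷ⁽ᵏ⁾‖²_{Λ⁻¹} + ‖x − x̂⁽ᵏ⁾‖²_{Γ⁻¹} ≥ 2yᵀDx̂⁽ᵏ⁺¹⁾ − 2(ŷ⁽ᵏ⁺¹⁾)ᵀDx + ‖y − ŷ⁽ᵏ⁺¹⁾‖²_{Λ⁻¹}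
+ ‖x − x̂⁽ᵏ⁺¹⁾‖²_{Γ⁻¹} + ‖ŷ⁽ᵏ⁾ − ŷ⁽ᵏ⁺¹⁾‖²_{Λ⁻¹} + ‖x̂⁽ᵏ⁾ − x̂⁽ᵏ⁺¹⁾‖²_{Γ⁻¹}
+ 2(x̂⁽ᵏ⁺¹⁾ − x̄)ᵀ Dᵀ (ŷ⁽ᵏ⁺¹⁾ − y)`. -/
theorem slp_single_iteration_estimate
    {V E : Type*} [Fintype V] [Fintype E] [DecidableEq V] [DecidableEq E]
    (D : Matrix E V ℝ)
    (γ : V → ℝ) (hγ : ∀ i, 0 < γ i) (lam : E → ℝ) (hlam : ∀ e, 0 < lam e)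
    (M : Set V) (xtil : V → ℝ)
    (Q : Set (V → ℝ)) (hQ : Q = {x : V → ℝ | ∀ i ∈ M, x i = xtil i})
    (xkm xk : V → ℝ) (yk : E → ℝ)
    (xbar : V → ℝ) (hxbar : xbar = (2:ℝ) • xk - xkm)
    (yk1 : E → ℝ)
    (hy : IsMinimizer (linfBall E) (slpDualObj D (Matrix.diagonal lam) yk xbar) yk1)
    (xk1 : V → ℝ)
    (hx : IsMinimizer Q (slpPrimalObj D (Matrix.diagonal γ) xk yk1) xk1) :
    ∀ x ∈ Q, ∀ y ∈ linfBall E,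
      wnormSq (Matrix.diagonal lam)⁻¹ (y - yk) + wnormSq (Matrix.diagonal γ)⁻¹ (x - xk) ≥
        2 * (y ⬝ᵥ (D *ᵥ xk1)) - 2 * (yk1 ⬝ᵥ (D *ᵥ x)) +
          wnormSq (Matrix.diagonal lam)⁻¹ (y - yk1) +
          wnormSq (Matrix.diagonal γ)⁻¹ (x - xk1) +
          wnormSq (Matrix.diagonal lam)⁻¹ (yk - yk1) +
          wnormSq (Matrix.diagonal γ)⁻¹ (xk - xk1) +
          2 * ((xk1 - xbar) ⬝ᵥ (Dᵀ *ᵥ (yk1 - y))) := by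
  intro x hxQ y hyB
  have hdual := IsMinimizer.wnormSq_three_point (isSymm_diagonal lam)
    (isUnit_det_diagonal_of_pos hlam) (convex_linfBall E) (q := D *ᵥ xbar) hy hyB
  have hx' : IsMinimizer Q (fun z => (1 / 2) * wnormSq (Matrix.diagonal γ)⁻¹
      (xk + Matrix.diagonal γ *ᵥ (-(Dᵀ *ᵥ yk1)) - z)) xk1 := by
    simp only [mulVec_neg, ← sub_eq_add_neg]
    exact hx
  have hprimal := hx'.wnormSq_three_point (isSymm_diagonal γ)
    (isUnit_det_diagonal_of_pos hγ) (hQ ▸ convex_setOf_eqOn M xtil) hxQ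
  have hadj : ∀ (u : V → ℝ) (v : E → ℝ), u ⬝ᵥ (Dᵀ *ᵥ v) = v ⬝ᵥ (D *ᵥ u) := fun u v => by
    rw [mulVec_transpose, dotProduct_comm, ← dotProduct_mulVec]
  simp only [dotProduct_neg, hadj, mulVec_sub, dotProduct_sub, sub_dotProduct] at hdual hprimal ⊢
  linarith

end
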